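/- arXiv:1603.08073 — 5 statements merged into one kernel-verified Lean document; each statement's English description precedes it below -/
import Mathlib

section
/- Let n ≥ 2, let R be a commutative ring, let A = (a_{ij}) be a symmetric 2n×2n matrix over R, and let i, j be distinct indices. Then haf A = a_{ij} · haf A[i,j] + Σ_{{p,q}} (a_{ip} a_{jq} + a_{iq} a_{jp}) · haf A[i,j,p,q], where the sum is over all unordered pairs {p,q} of distinct indices p, q ∈ {1,…,2n} \ {i,j}. -/
-- The hafnian of a matrix: the sum over all partitions of the index set into
-- unordered pairs (encoded as fixed-point-free involutions, taking each pair once)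
-- of the product of the corresponding entries.  For symmetric matrices this is the
-- usual hafnian.
open Classical in
noncomputable def haf {ι : Type*} [Fintype ι] {R : Type*} [CommRing R]
    (M : Matrix ι ι R) : R :=
  ∑ σ ∈ Finset.univ.filter
      (fun σ : Equiv.Perm ι => σ * σ = 1 ∧ ∀ i, σ i ≠ i),
    ∏ i ∈ Finset.univ.filter
      (fun i => Fintype.equivFin ι i < Fintype.equivFin ι (σ i)),
      M i (σ i)

/-- `A[i,j]`: the matrix obtained from `A` by deleting rows `i,j` and columns `i,j`. -/
def delTwo {n : ℕ} {R : Type*} [CommRing R] (A : Matrix (Fin n) (Fin n) R)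
    (i j : Fin n) : Matrix {k : Fin n // k ≠ i ∧ k ≠ j} {k : Fin n // k ≠ i ∧ k ≠ j} R :=
  A.submatrix (fun k => (k : Fin n)) (fun k => (k : Fin n))

/-- `A[i,j,p,q] = (A[i,j])[p,q]`: the matrix obtained from `A` by deleting rows and
columns `i,j,p,q`. -/
def delFour {n : ℕ} {R : Type*} [CommRing R] (A : Matrix (Fin n) (Fin n) R)
    (i j p q : Fin n) :
    Matrix {k : Fin n // k ≠ i ∧ k ≠ j ∧ k ≠ p ∧ k ≠ q}
      {k : Fin n // k ≠ i ∧ k ≠ j ∧ k ≠ p ∧ k ≠ q} R :=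
  A.submatrix (fun k => (k : Fin n)) (fun k => (k : Fin n))

section MatchingSum

theorem mul_self_eq_one_iff_apply {ι : Type*} (σ : Equiv.Perm ι) :
    σ * σ = 1 ↔ ∀ x, σ (σ x) = x := by
  simp [Equiv.ext_iff]

variable {ι : Type*} [Fintype ι] [DecidableEq ι] {R : Type*} [CommRing R]

/-- The product of the values of `f` over the unordered pairs `{x, σ x}` with `x ∈ S`. -/
def pairProd (f : Sym2 ι → R) (S : Finset ι) (σ : Equiv.Perm ι) : R :=
  ∏ z ∈ S.image (fun x => s(x, σ x)), f z

/-- The sum of `pairProd f S σ` over the perfect matchings of `S`, encoded as the involutions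
with support `S`. -/
def matchingSum (f : Sym2 ι → R) (S : Finset ι) : R :=
  ∑ σ ∈ Finset.univ.filter (fun σ : Equiv.Perm ι => σ * σ = 1 ∧ σ.support = S), pairProd f S σ

/-- The pairs of a fixed-point-free involution can be enumerated by their smaller elements with
respect to any injection into a linear order. -/
theorem prod_filter_lt_eq_pairProd {κ : Type*} [LinearOrder κ] (g : ι → κ)
    (hg : Function.Injective g) (f : Sym2 ι → R) (σ : Equiv.Perm ι)
    (h1 : σ * σ = 1) (h2 : ∀ x, σ x ≠ x) :
    ∏ x ∈ Finset.univ.filter (fun x => g x < g (σ x)), f s(x, σ x) =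
      pairProd f Finset.univ σ := by
  rw [mul_self_eq_one_iff_apply] at h1
  have himage : Finset.univ.image (fun x => s(x, σ x)) =
      (Finset.univ.filter (fun x => g x < g (σ x))).image (fun x => s(x, σ x)) := by
    apply Finset.Subset.antisymm
    · intro z hz
      obtain ⟨x, -, rfl⟩ := Finset.mem_image.1 hz
      rcases lt_trichotomy (g x) (g (σ x)) with h | h | h
      · exact Finset.mem_image.2 ⟨x, by simp [h], rfl⟩
      · exact absurd (hg h).symm (h2 x)
      · exact Finset.mem_image.2 ⟨σ x, by simp [h, h1], by simp [h1, Sym2.eq_swap]⟩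
    · exact Finset.image_subset_image (Finset.filter_subset _ _)
  rw [pairProd, himage, Finset.prod_image]
  intro x hx y hy hxy
  simp only [Finset.coe_filter, Finset.mem_univ, true_and, Set.mem_ofPred_eq] at hx hy
  rcases Sym2.eq_iff.1 hxy with ⟨h, -⟩ | ⟨h, h'⟩
  · exact h
  · rw [h', h] at hx
    exact absurd hx (lt_asymm hy)

theorem haf_eq_sum_pairProd (M : Matrix ι ι R) (f : Sym2 ι → R) (hf : ∀ x y, f s(x, y) = M x y) :
    haf M = ∑ σ ∈ Finset.univ.filter (fun σ : Equiv.Perm ι => σ * σ = 1 ∧ ∀ x, σ x ≠ x),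
      pairProd f Finset.univ σ := by
  classical
  rw [haf]
  refine Finset.sum_congr (by ext; simp) fun σ hσ => ?_
  obtain ⟨h1, h2⟩ := (Finset.mem_filter.1 hσ).2
  rw [← prod_filter_lt_eq_pairProd _ (Fintype.equivFin ι).injective f σ h1 h2]
  exact Finset.prod_congr (by ext; simp) fun x _ => (hf _ _).symm

theorem haf_eq_matchingSum (M : Matrix ι ι R) (f : Sym2 ι → R) (hf : ∀ x y, f s(x, y) = M x y) :
    haf M = matchingSum f Finset.univ := by
  rw [haf_eq_sum_pairProd M f hf, matchingSum]
  refine Finset.sum_congr ?_ fun _ _ => rfl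
  ext σ
  simp [Finset.ext_iff]

theorem haf_submatrix_val_eq_matchingSum (M : Matrix ι ι R) (f : Sym2 ι → R)
    (hf : ∀ x y, f s(x, y) = M x y) (P : ι → Prop) [DecidablePred P] :
    haf (M.submatrix (Subtype.val : {x // P x} → ι) Subtype.val) =
      matchingSum f (Finset.univ.filter P) := by
  rw [haf_eq_sum_pairProd _ (fun z => f (z.map Subtype.val)) (by simp [hf]), matchingSum]
  refine Finset.sum_bij (fun σ _ => Equiv.Perm.ofSubtype σ) ?_ ?_ ?_ ?_
  · intro σ hσ
    obtain ⟨h1, h2⟩ := (Finset.mem_filter.1 hσ).2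
    refine Finset.mem_filter.2 ⟨Finset.mem_univ _, by rw [← map_mul, h1, map_one], ?_⟩
    ext x
    by_cases hx : P x
    · have := h2 ⟨x, hx⟩
      simpa [hx, Equiv.Perm.ofSubtype_apply_of_mem σ hx, Subtype.ext_iff] using this
    · simp [hx, Equiv.Perm.ofSubtype_apply_of_not_mem σ hx]
  · intro σ _ τ _ h
    exact Equiv.Perm.ofSubtype_injective h
  · intro τ hτ
    obtain ⟨h1, h2⟩ := (Finset.mem_filter.1 hτ).2
    have hP : ∀ x, P x ↔ τ x ≠ x := fun x => by
      rw [← Equiv.Perm.mem_support, h2]; simp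
    have hP' : ∀ x, P (τ x) ↔ P x := fun x => by
      simp [hP]
    have hof : Equiv.Perm.ofSubtype (τ.subtypePerm hP') = τ :=
      Equiv.Perm.ofSubtype_subtypePerm hP' fun x hx => (hP x).2 hx
    refine ⟨τ.subtypePerm hP', Finset.mem_filter.2 ⟨Finset.mem_univ _, ?_, ?_⟩, hof⟩
    · apply Equiv.Perm.ofSubtype_injective
      rw [map_mul, hof, h1, map_one]
    · rintro ⟨x, hx⟩ h
      exact (hP x).1 hx (Subtype.ext_iff.1 h)
  · intro σ _
    rw [pairProd, pairProd]
    have himage : (Finset.univ.filter P).image (fun x => s(x, Equiv.Perm.ofSubtype σ x)) =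
        (Finset.univ.image (fun x => s(x, σ x))).image (Sym2.map Subtype.val) := by
      ext z
      rw [Finset.image_image]
      simp only [Finset.mem_image, Finset.mem_filter, Finset.mem_univ, true_and]
      constructor
      · rintro ⟨x, hx, rfl⟩
        exact ⟨⟨x, hx⟩, by simp [Equiv.Perm.ofSubtype_apply_of_mem σ hx]⟩
      · rintro ⟨⟨x, hx⟩, rfl⟩
        exact ⟨x, hx, by simp [Equiv.Perm.ofSubtype_apply_of_mem σ hx]⟩
    rw [himage]
    exact (Finset.prod_image fun _ _ _ _ h => Sym2.map.injective Subtype.val_injective h).symm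

theorem pairProd_swap_mul (f : Sym2 ι → R) {S : Finset ι} {i k : ι} (hi : i ∈ S)
    {τ : Equiv.Perm ι} (hτ : τ.support = (S.erase i).erase k) :
    pairProd f S (Equiv.swap i k * τ) = f s(i, k) * pairProd f ((S.erase i).erase k) τ := by
  have hfix : ∀ x, x ∉ (S.erase i).erase k → τ x = x := fun x hx => by
    rwa [← hτ, Equiv.Perm.notMem_support] at hx
  have hmem : ∀ x ∈ (S.erase i).erase k, τ x ∈ (S.erase i).erase k := fun x hx => by
    rw [← hτ] at hx ⊢
    exact Equiv.Perm.apply_mem_support.2 hx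
  have hτi : τ i = i := hfix i (by simp)
  have hτk : τ k = k := hfix k (by simp)
  have hother : ∀ x ∈ (S.erase i).erase k, (Equiv.swap i k * τ) x = τ x := fun x hx => by
    have := hmem x hx
    simp only [Finset.mem_erase] at this
    exact Equiv.swap_apply_of_ne_of_ne this.2.1 this.1
  have himage : S.image (fun x => s(x, (Equiv.swap i k * τ) x)) =
      insert s(i, k) (((S.erase i).erase k).image (fun x => s(x, τ x))) := by
    ext z
    simp only [Finset.mem_insert, Finset.mem_image]
    constructor
    · rintro ⟨x, hx, rfl⟩
      by_cases hxi : x = i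
      · left; simp [hxi, hτi]
      by_cases hxk : x = k
      · left; simp [hxk, hτk, Sym2.eq_swap]
      have hx' : x ∈ (S.erase i).erase k := by simp [*]
      exact Or.inr ⟨x, hx', by rw [hother x hx']⟩
    · rintro (rfl | ⟨x, hx, rfl⟩)
      · exact ⟨i, hi, by simp [hτi]⟩
      · exact ⟨x, Finset.mem_of_mem_erase (Finset.mem_of_mem_erase hx), by rw [hother x hx]⟩
  rw [pairProd, himage, Finset.prod_insert, pairProd]
  intro h
  obtain ⟨x, hx, h⟩ := Finset.mem_image.1 h
  simp only [Finset.mem_erase] at hx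
  rcases Sym2.eq_iff.1 h with ⟨h, -⟩ | ⟨h, -⟩
  · exact hx.2.1 h
  · exact hx.1 h

/-- Expansion of a matching sum along the pairs containing `i`. -/
theorem matchingSum_expansion (f : Sym2 ι → R) {S : Finset ι} {i : ι} (hi : i ∈ S) :
    matchingSum f S =
      ∑ k ∈ S.erase i, f s(i, k) * matchingSum f ((S.erase i).erase k) := by
  rw [matchingSum, ← Finset.sum_fiberwise_of_maps_to (t := S.erase i) (g := fun σ => σ i)]
  · refine Finset.sum_congr rfl fun k hk => ?_
    obtain ⟨hki, hkS⟩ := Finset.mem_erase.1 hk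
    rw [matchingSum, Finset.mul_sum]
    symm
    refine Finset.sum_nbij' (fun τ => Equiv.swap i k * τ) (fun σ => Equiv.swap i k * σ)
      ?_ ?_ ?_ ?_ ?_
    · intro τ hτ
      obtain ⟨h1, h2⟩ := (Finset.mem_filter.1 hτ).2
      rw [mul_self_eq_one_iff_apply] at h1
      have hs : ∀ x, τ x ≠ x ↔ x ∈ (S.erase i).erase k := fun x => by
        rw [← h2, Equiv.Perm.mem_support]
      have hτi : τ i = i := by by_contra h; simpa using (hs i).1 h
      have hτk : τ k = k := by by_contra h; simpa using (hs k).1 h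
      simp only [Finset.mem_filter, Finset.mem_univ, true_and, mul_self_eq_one_iff_apply,
        Finset.ext_iff, Equiv.Perm.mem_support, Equiv.Perm.mul_apply, Equiv.swap_apply_def]
      simp only [Finset.mem_erase] at hs
      refine ⟨⟨fun x => ?_, fun x => ?_⟩, ?_⟩ <;> grind
    · intro σ hσ
      simp only [Finset.mem_filter, Finset.mem_univ, true_and, mul_self_eq_one_iff_apply,
        Finset.ext_iff, Equiv.Perm.mem_support, Equiv.Perm.mul_apply, Equiv.swap_apply_def,
        Finset.mem_erase] at hσ ⊢
      obtain ⟨⟨h1, hs⟩, hik⟩ := hσ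
      refine ⟨fun x => ?_, fun x => ?_⟩ <;> grind
    · intro τ _
      simp [← mul_assoc]
    · intro σ _
      simp [← mul_assoc]
    · intro τ hτ
      exact (pairProd_swap_mul f hi (Finset.mem_filter.1 hτ).2.2).symm
  · intro σ hσ
    obtain ⟨-, h2⟩ := (Finset.mem_filter.1 hσ).2
    subst h2
    exact Finset.mem_erase.2
      ⟨Equiv.Perm.mem_support.1 hi, Equiv.Perm.apply_mem_support.2 hi⟩

end MatchingSum

/-- For a symmetric `2n × 2n` matrix (`n ≥ 2`) and distinct indices
`i, j`:
`haf A = a_{ij}·haf A[i,j] + Σ_{{p,q}} (a_{ip}a_{jq} + a_{iq}a_{jp})·haf A[i,j,p,q]`,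
the sum being over unordered pairs `{p,q}` of distinct indices avoiding `i, j`
(encoded as ordered pairs with `p < q`). -/
theorem haf_expansion_two {n : ℕ} (hn : 2 ≤ n) {R : Type*} [CommRing R]
    (A : Matrix (Fin (2 * n)) (Fin (2 * n)) R) (hA : A.IsSymm)
    (i j : Fin (2 * n)) (hij : i ≠ j) :
    haf A = A i j * haf (delTwo A i j) +
      ∑ pq ∈ Finset.univ.filter
          (fun pq : Fin (2 * n) × Fin (2 * n) =>
            pq.1 < pq.2 ∧ pq.1 ≠ i ∧ pq.1 ≠ j ∧ pq.2 ≠ i ∧ pq.2 ≠ j),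
        (A i pq.1 * A j pq.2 + A i pq.2 * A j pq.1) *
          haf (delFour A i j pq.1 pq.2) := by
  let f : Sym2 (Fin (2 * n)) → R := Sym2.lift ⟨fun x y => A x y, fun x y => (hA.apply x y).symm⟩
  have hf : ∀ x y, f s(x, y) = A x y := fun _ _ => rfl
  have htwo : haf (delTwo A i j) = matchingSum f ((Finset.univ.erase i).erase j) := by
    rw [delTwo, haf_submatrix_val_eq_matchingSum A f hf]
    congr 1
    ext x
    simp [and_comm]
  have hfour : ∀ p q, haf (delFour A i j p q) =
      matchingSum f (Finset.univ.filter fun x => x ≠ i ∧ x ≠ j ∧ x ≠ p ∧ x ≠ q) :=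
    fun p q => haf_submatrix_val_eq_matchingSum A f hf _
  have hsymm : ∀ p q, haf (delFour A i j p q) = haf (delFour A i j q p) := fun p q => by
    rw [hfour, hfour]
    congr 1
    ext x
    simp [and_comm]
  rw [haf_eq_matchingSum A f hf, matchingSum_expansion f (Finset.mem_univ i),
    ← Finset.add_sum_erase _ _ (by simp [hij.symm] : j ∈ Finset.univ.erase i), htwo, hf]
  congr 1
  have hrow : ∀ p ∈ (Finset.univ.erase i).erase j,
      f s(i, p) * matchingSum f ((Finset.univ.erase i).erase p) =
        ∑ q ∈ Finset.univ.filter (fun q => q ≠ i ∧ q ≠ j ∧ q ≠ p),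
          A i p * A j q * haf (delFour A i j p q) := by
    intro p hp
    simp only [Finset.mem_erase, Finset.mem_univ, and_true] at hp
    rw [matchingSum_expansion f (i := j) (by simp [hij.symm, hp.1.symm]), Finset.mul_sum]
    refine Finset.sum_congr (by ext; simp; tauto) fun q _ => ?_
    rw [hfour, hf, hf, mul_assoc]
    congr 3
    ext x
    simp
    tauto
  rw [Finset.sum_congr rfl hrow, ← Finset.sum_finset_product'
    (Finset.univ.filter fun pq : Fin (2 * n) × Fin (2 * n) =>
      pq.1 ≠ pq.2 ∧ pq.1 ≠ i ∧ pq.1 ≠ j ∧ pq.2 ≠ i ∧ pq.2 ≠ j) _ _ (by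
        rintro ⟨p, q⟩; simp; grind),
    ← Finset.sum_filter_add_sum_filter_not _ (fun pq => pq.1 < pq.2)]
  simp only [add_mul, Finset.sum_add_distrib]
  congr 1
  · exact Finset.sum_congr (by ext ⟨p, q⟩; simp; grind) fun _ _ => rfl
  · refine Finset.sum_nbij' Prod.swap Prod.swap ?_ ?_ (by simp) (by simp) ?_
    · rintro ⟨p, q⟩; simp; grind
    · rintro ⟨p, q⟩; simp; grind
    · rintro ⟨p, q⟩ -
      rw [hsymm]
      rfl
end

section
/- Let R be a commutative ring, let A = (a_{ij}) be a symmetric 2n×2n matrix over R with zero diagonal, let i ≠ j be indices, and let c ∈ R. Then haf A(i,j;c) = haf A + c · haf A(i→j). -/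
/-- `A(i,j;c)`: the matrix obtained from `A` by adding `c` times column `i` to
column `j`, adding `c` times row `i` to row `j`, and replacing the `(j,j)` entry
by zero. -/
def rowColOp {n : ℕ} {R : Type*} [CommRing R] [DecidableEq (Fin n)]
    (A : Matrix (Fin n) (Fin n) R) (i j : Fin n) (c : R) :
    Matrix (Fin n) (Fin n) R :=
  Matrix.of fun k l =>
    if k = j then (if l = j then 0 else A j l + c * A i l)
    else (if l = j then A k j + c * A k i else A k l)

/-- `A(i→j)`: the matrix obtained from `A` by replacing row `j` with row `i` and
column `j` with column `i` (the `(j,j)` entry becomes `a_{ii}`). -/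
def replaceRowCol {n : ℕ} {R : Type*} [CommRing R] [DecidableEq (Fin n)]
    (A : Matrix (Fin n) (Fin n) R) (i j : Fin n) :
    Matrix (Fin n) (Fin n) R :=
  Matrix.of fun k l =>
    if k = j then (if l = j then A i i else A i l)
    else (if l = j then A k i else A k l)

/-- For a fixed-point-free involution `σ`, taking from each pair the element where the injection
`e` is smaller, exactly one representative lies in the pair containing `j`. -/
theorem exists_pair_representative {ι α : Type*} [LinearOrder α] (e : ι → α)
    (he : Function.Injective e) (σ : Equiv.Perm ι) (hσ : σ * σ = 1) (hfix : ∀ k, σ k ≠ k)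
    (j : ι) :
    ∃ r, e r < e (σ r) ∧ (r = j ∨ σ r = j) ∧
      ∀ k, e k < e (σ k) → k ≠ r → k ≠ j ∧ σ k ≠ j := by
  have hinv : ∀ k, σ (σ k) = k := fun k => by
    simpa using congrArg (fun τ : Equiv.Perm ι => τ k) hσ
  rcases lt_or_gt_of_ne (he.ne (hfix j)) with h | h
  · refine ⟨σ j, by rwa [hinv], Or.inr (hinv j), fun k hk hkr => ⟨?_, ?_⟩⟩
    · rintro rfl
      exact lt_asymm h hk
    · rintro rfl
      exact hkr (hinv k).symm
  · refine ⟨j, h, Or.inl rfl, fun k hk hkr => ⟨hkr, ?_⟩⟩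
    rintro rfl
    rw [hinv] at h
    exact lt_asymm h hk

/-- For a symmetric `2n × 2n` matrix `A` with zero diagonal,
distinct indices `i ≠ j` and a ring element `c`:
`haf A(i,j;c) = haf A + c · haf A(i→j)`. -/
theorem haf_rowColOp {n : ℕ} {R : Type*} [CommRing R]
    (A : Matrix (Fin (2 * n)) (Fin (2 * n)) R) (hA : A.IsSymm)
    (hdiag : ∀ k, A k k = 0) (i j : Fin (2 * n)) (hij : i ≠ j) (c : R) :
    haf (rowColOp A i j c) = haf A + c * haf (replaceRowCol A i j) := by
  unfold haf
  rw [Finset.mul_sum, ← Finset.sum_add_distrib]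
  refine Finset.sum_congr rfl fun σ hmem => ?_
  simp only [Finset.mem_filter, Finset.mem_univ, true_and] at hmem
  obtain ⟨hσ, hfix⟩ := hmem
  obtain ⟨r, hr, hrj, hrest⟩ := exists_pair_representative _
    (Fintype.equivFin (Fin (2 * n))).injective σ hσ hfix j
  have hrS : r ∈ Finset.univ.filter
      (fun k => Fintype.equivFin (Fin (2 * n)) k < Fintype.equivFin (Fin (2 * n)) (σ k)) :=
    Finset.mem_filter.mpr ⟨Finset.mem_univ r, hr⟩
  rw [← Finset.mul_prod_erase _ _ hrS, ← Finset.mul_prod_erase _ _ hrS,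
    ← Finset.mul_prod_erase _ _ hrS]
  have hsplit : rowColOp A i j c r (σ r) =
      A r (σ r) + c * replaceRowCol A i j r (σ r) := by
    have hne := hfix r
    rcases hrj with rfl | h
    · simp [rowColOp, replaceRowCol, hne]
    · have hr' : r ≠ j := fun h' => hne (h.trans h'.symm)
      simp [rowColOp, replaceRowCol, h, hr']
  rw [hsplit, Finset.prod_congr rfl (g := fun k => A k (σ k)),
    Finset.prod_congr (f := fun k => replaceRowCol A i j k (σ k)) rfl
      (g := fun k => A k (σ k))]
  · ring
  all_goals
    intro k hk
    obtain ⟨hkr, hkS⟩ := Finset.mem_erase.mp hk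
    obtain ⟨h₁, h₂⟩ := hrest k (Finset.mem_filter.mp hkS).2 hkr
    simp [rowColOp, replaceRowCol, h₁, h₂]
end

section
/- Let R be a commutative ring in which 2 = 0, and let A be a symmetric 2n×2n matrix over R with zero diagonal. Then (haf A)² = det A. (This is the fact that modulo 2 the hafnian of A coincides with the Pfaffian of the associated skew-symmetric matrix, whose square is the determinant.) -/
/-- The square of the weight of a perfect matching is the weight of the corresponding
fixed-point-free involution. -/
theorem Matrix.IsSymm.sq_prod_lt_eq_prod {ι α R : Type*} [Fintype ι] [LinearOrder α] [CommRing R]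
    {M : Matrix ι ι R} (hM : M.IsSymm) {e : ι → α} (he : Function.Injective e)
    {σ : Equiv.Perm ι} (hσ : σ * σ = 1) (hfix : ∀ i, σ i ≠ i)
    [DecidablePred fun i => e i < e (σ i)] :
    (∏ i ∈ Finset.univ.filter (fun i => e i < e (σ i)), M i (σ i)) ^ 2 = ∏ i, M i (σ i) := by
  have hinv : ∀ i, σ (σ i) = i := fun i => by rw [← Equiv.Perm.mul_apply, hσ, Equiv.Perm.one_apply]
  rw [← Finset.prod_filter_mul_prod_filter_not Finset.univ (fun i => e i < e (σ i)), sq]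
  congr 1
  refine Finset.prod_bij' (fun i _ => σ i) (fun i _ => σ i) ?_ ?_ ?_ ?_ ?_
  · simp only [Finset.mem_filter, Finset.mem_univ, true_and, hinv, not_lt]
    exact fun _ h => h.le
  · simp only [Finset.mem_filter, Finset.mem_univ, true_and, hinv, not_lt]
    exact fun i h => lt_of_le_of_ne h fun h' => hfix i (he h')
  · exact fun i _ => hinv i
  · exact fun i _ => hinv i
  · intro i _
    rw [hinv, hM.apply]

/-- In characteristic two, the determinant of a symmetric matrix with zero diagonal is the sum of
the weights of the fixed-point-free involutions. -/
theorem Matrix.IsSymm.det_eq_sum_involutions {ι R : Type*} [Fintype ι] [DecidableEq ι] [CommRing R]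
    [CharP R 2] {M : Matrix ι ι R} (hM : M.IsSymm) (hdiag : ∀ i, M i i = 0)
    [DecidablePred fun σ : Equiv.Perm ι => σ * σ = 1 ∧ ∀ i, σ i ≠ i] :
    M.det = ∑ σ ∈ Finset.univ.filter (fun σ : Equiv.Perm ι => σ * σ = 1 ∧ ∀ i, σ i ≠ i),
      ∏ i, M i (σ i) := by
  have hdet : M.det = ∑ σ : Equiv.Perm ι, ∏ i, M i (σ i) := by
    rw [Matrix.det_apply]
    refine Finset.sum_congr rfl fun σ _ => ?_
    rcases Int.units_eq_one_or (Equiv.Perm.sign σ) with h | h <;>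
      simp [h, hM.apply, CharTwo.neg_eq]
  rw [hdet, ← Finset.sum_filter_add_sum_filter_not Finset.univ
    (fun σ : Equiv.Perm ι => σ * σ = 1 ∧ ∀ i, σ i ≠ i), add_eq_left]
  refine Finset.sum_involution (fun σ _ => σ⁻¹) ?_ ?_ ?_ ?_
  · intro σ _
    have h : ∏ i, M i (σ⁻¹ i) = ∏ i, M i (σ i) := by
      rw [← Equiv.prod_comp σ]
      simp [hM.apply]
    rw [h, CharTwo.add_self_eq_zero]
  · intro σ hσ hne hinv
    refine (Finset.mem_filter.mp hσ).2 ⟨?_, fun i hi => hne ?_⟩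
    · rw [← inv_eq_iff_mul_eq_one, hinv]
    · exact Finset.prod_eq_zero (Finset.mem_univ i) (by rw [hi, hdiag])
  · intro σ hσ
    simp only [Finset.mem_filter, Finset.mem_univ, true_and] at hσ ⊢
    rintro ⟨h, hfix⟩
    have h' : σ = σ⁻¹ := (inv_inv σ).symm.trans (inv_eq_of_mul_eq_one_left h)
    exact hσ (by rw [h']; exact ⟨h, hfix⟩)
  · exact fun σ _ => inv_inv σ

/-- Over a commutative ring in which `2 = 0`, the square of the
hafnian of a symmetric `2n × 2n` matrix with zero diagonal equals its determinant
(i.e. mod 2 the hafnian is the Pfaffian of the associated skew-symmetric matrix). -/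
theorem haf_sq_eq_det {n : ℕ} {R : Type*} [CommRing R] (h2 : (2 : R) = 0)
    (A : Matrix (Fin (2 * n)) (Fin (2 * n)) R) (hA : A.IsSymm)
    (hdiag : ∀ k, A k k = 0) :
    (haf A) ^ 2 = A.det := by
  classical
  rcases subsingleton_or_nontrivial R with _ | _
  · exact Subsingleton.elim _ _
  have : CharP R 2 := CharTwo.of_one_ne_zero_of_two_eq_zero one_ne_zero h2
  rw [hA.det_eq_sum_involutions hdiag, haf, CharTwo.sum_sq]
  refine Finset.sum_congr (by ext; simp) fun σ hσ => ?_
  obtain ⟨h, hfix⟩ := (Finset.mem_filter.mp hσ).2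
  exact hA.sq_prod_lt_eq_prod (Fintype.equivFin _).injective h hfix
end

section
/- Let n ≥ 2, let R be a commutative ring, let A = (a_{ij}) be a symmetric 2n×2n matrix over R with zero diagonal, and let i ≠ j be indices. Then haf A(i→j) = Σ_{{p,q}} 2·a_{ip} a_{iq} · haf A[i,j,p,q], where the sum is over all unordered pairs {p,q} of distinct indices p, q ∈ {1,…,2n} \ {i,j}. In particular, haf A(i→j) is divisible by 2 in R. -/
/-- The weight of a fixed-point-free involution does not depend on the ordering used to select
one element from each of its orbits. -/
theorem prod_filter_lt_involution_congr {ι R α β : Type*} [Fintype ι] [CommRing R]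
    [LinearOrder α] [LinearOrder β] {M : Matrix ι ι R} (hM : M.IsSymm) {σ : Equiv.Perm ι}
    (hσ : ∀ k, σ (σ k) = k) (hfix : ∀ k, σ k ≠ k) {g : ι → α} {h : ι → β}
    (hg : Function.Injective g) (hh : Function.Injective h) :
    ∏ k with g k < g (σ k), M k (σ k) = ∏ k with h k < h (σ k), M k (σ k) := by
  have hg' : ∀ k, g k < g (σ k) ∨ g (σ k) < g k := fun k =>
    lt_or_gt_of_ne (hg.ne (hfix k).symm)
  have hh' : ∀ k, h k < h (σ k) ∨ h (σ k) < h k := fun k =>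
    lt_or_gt_of_ne (hh.ne (hfix k).symm)
  refine Finset.prod_bij' (fun k _ => if h k < h (σ k) then k else σ k)
    (fun k _ => if g k < g (σ k) then k else σ k) ?_ ?_ ?_ ?_ ?_
  · intro k hk
    split_ifs with hlt
    · simpa using hlt
    · simpa [hσ] using (hh' k).resolve_left hlt
  · intro k hk
    split_ifs with hlt
    · simpa using hlt
    · simpa [hσ] using (hg' k).resolve_left hlt
  · intro k hk
    have hk : g k < g (σ k) := by simpa using hk
    split_ifs <;> simp_all [hk.not_gt]
  · intro k hk
    have hk : h k < h (σ k) := by simpa using hk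
    split_ifs <;> simp_all [hk.not_gt]
  · intro k hk
    split_ifs
    · rfl
    · rw [hσ, hM.apply]

theorem haf_submatrix_val_congr {ι R : Type*} [CommRing R] (M : Matrix ι ι R) {P Q : ι → Prop}
    {_ : Fintype {k // P k}} {_ : Fintype {k // Q k}} (h : ∀ k, P k ↔ Q k) :
    haf (M.submatrix (Subtype.val : {k // P k} → ι) Subtype.val) =
      haf (M.submatrix (Subtype.val : {k // Q k} → ι) Subtype.val) := by
  obtain rfl : P = Q := funext fun k => propext (h k)
  congr!

open Classical in
/-- The weight of a fixed-point-free involution containing the pairs `{i, p}` and `{j, q}` factors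
through its restriction `τ` to the complement of these pairs. -/
theorem prod_filter_lt_involution_eq_mul {ι R : Type*} [Fintype ι] [CommRing R]
    {M : Matrix ι ι R} (hM : M.IsSymm) {i j p q : ι}
    (hij : i ≠ j) (hpi : p ≠ i) (hpj : p ≠ j) (hqi : q ≠ i) (hqj : q ≠ j) (hpq : p ≠ q)
    {σ : Equiv.Perm ι} (hσ : ∀ k, σ (σ k) = k) (hi : σ i = p) (hj : σ j = q)
    (hfix : ∀ k, σ k ≠ k)
    (τ : Equiv.Perm {k // k ≠ i ∧ k ≠ j ∧ k ≠ p ∧ k ≠ q}) (hτ : ∀ k, (τ k : ι) = σ k) :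
    ∏ k with Fintype.equivFin ι k < Fintype.equivFin ι (σ k), M k (σ k) =
      M i p * M j q *
        ∏ k with Fintype.equivFin _ k < Fintype.equivFin _ (τ k),
          M.submatrix Subtype.val Subtype.val k (τ k) := by
  have hp : σ p = i := by rw [← hi, hσ]
  have hq : σ q = j := by rw [← hj, hσ]
  have hpair : ∀ a b, a ≠ b →
      (if Fintype.equivFin ι a < Fintype.equivFin ι b then M a b else 1) *
        (if Fintype.equivFin ι b < Fintype.equivFin ι a then M b a else 1) = M a b := by
    intro a b hab
    rcases lt_or_gt_of_ne ((Fintype.equivFin ι).injective.ne hab) with h | h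
    · simp [h, h.not_gt]
    · simp [h, h.not_gt, hM.apply]
  rw [prod_filter_lt_involution_congr (g := Fintype.equivFin {k // k ≠ i ∧ k ≠ j ∧ k ≠ p ∧ k ≠ q})
    (h := fun k => Fintype.equivFin ι k.1) (hM.submatrix _)
    (fun k => Subtype.ext (by rw [hτ, hτ, hσ]))
    (fun k hk => hfix k (by rw [← hτ, hk])) (Fintype.equivFin _).injective
    ((Fintype.equivFin ι).injective.comp Subtype.val_injective),
    Finset.prod_filter, Finset.prod_filter,
    ← Finset.prod_mul_prod_compl ({i, p, j, q} : Finset ι)]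
  congr 1
  · rw [Finset.prod_insert (by simp [*, hpi.symm, hqi.symm]),
      Finset.prod_insert (by simp [*]), Finset.prod_insert (by simp [*, hqj.symm]),
      Finset.prod_singleton, hi, hj, hp, hq, ← mul_assoc, hpair i p hpi.symm, hpair j q hqj.symm]
  · rw [Finset.prod_subtype (p := fun k => k ≠ i ∧ k ≠ j ∧ k ≠ p ∧ k ≠ q) (F := inferInstance)]
    · simp [hτ]
    · intro k
      simp only [Finset.mem_compl, Finset.mem_insert, Finset.mem_singleton]
      tauto

open Classical in
/-- The part of the hafnian coming from the perfect matchings containing `{i, p}` and `{j, q}`. -/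
theorem sum_involutions_pairs_eq_haf {ι R : Type*} [Fintype ι] [CommRing R]
    {M : Matrix ι ι R} (hM : M.IsSymm) {i j p q : ι}
    (hij : i ≠ j) (hpi : p ≠ i) (hpj : p ≠ j) (hqi : q ≠ i) (hqj : q ≠ j) (hpq : p ≠ q) :
    ∑ σ : Equiv.Perm ι with (σ * σ = 1 ∧ ∀ k, σ k ≠ k) ∧ (σ i = p ∧ σ j = q),
        ∏ k with Fintype.equivFin ι k < Fintype.equivFin ι (σ k), M k (σ k) =
      M i p * M j q *
        haf (M.submatrix (Subtype.val : {k // k ≠ i ∧ k ≠ j ∧ k ≠ p ∧ k ≠ q} → ι)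
          Subtype.val) := by
  have hinv : ∀ {κ : Type _} {σ : Equiv.Perm κ}, σ * σ = 1 → ∀ k, σ (σ k) = k := by
    intro κ σ h k
    rw [← Equiv.Perm.mul_apply, h, Equiv.Perm.one_apply]
  have hext : ∀ τ : Equiv.Perm {k // k ≠ i ∧ k ≠ j ∧ k ≠ p ∧ k ≠ q},
      ∀ k : {k // k ≠ i ∧ k ≠ j ∧ k ≠ p ∧ k ≠ q},
        (Equiv.swap i p * Equiv.swap j q * Equiv.Perm.ofSubtype τ) k = τ k := by
    intro τ k
    obtain ⟨h1, h2, h3, h4⟩ := (τ k).2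
    simp only [Equiv.Perm.mul_apply, Equiv.Perm.ofSubtype_apply_coe]
    rw [Equiv.swap_apply_of_ne_of_ne h2 h4, Equiv.swap_apply_of_ne_of_ne h1 h3]
  have hext' : ∀ τ : Equiv.Perm {k // k ≠ i ∧ k ≠ j ∧ k ≠ p ∧ k ≠ q}, ∀ k,
      ¬ (k ≠ i ∧ k ≠ j ∧ k ≠ p ∧ k ≠ q) →
        (Equiv.swap i p * Equiv.swap j q * Equiv.Perm.ofSubtype τ) k =
          Equiv.swap i p (Equiv.swap j q k) := by
    intro τ k hk
    simp only [Equiv.Perm.mul_apply]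
    rw [Equiv.Perm.ofSubtype_apply_of_not_mem τ hk]
  have ei : Equiv.swap i p (Equiv.swap j q i) = p := by
    rw [Equiv.swap_apply_of_ne_of_ne hij hqi.symm, Equiv.swap_apply_left]
  have ep : Equiv.swap i p (Equiv.swap j q p) = i := by
    rw [Equiv.swap_apply_of_ne_of_ne hpj hpq, Equiv.swap_apply_right]
  have ej : Equiv.swap i p (Equiv.swap j q j) = q := by
    rw [Equiv.swap_apply_left, Equiv.swap_apply_of_ne_of_ne hqi hpq.symm]
  have eq : Equiv.swap i p (Equiv.swap j q q) = j := by
    rw [Equiv.swap_apply_right, Equiv.swap_apply_of_ne_of_ne hij.symm hpj.symm]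
  have hcases : ∀ k, ¬ (k ≠ i ∧ k ≠ j ∧ k ≠ p ∧ k ≠ q) → k = i ∨ k = j ∨ k = p ∨ k = q := by
    intro k hk
    tauto
  have hstable : ∀ σ : Equiv.Perm ι, σ * σ = 1 → σ i = p → σ j = q → ∀ k,
      (σ k ≠ i ∧ σ k ≠ j ∧ σ k ≠ p ∧ σ k ≠ q) ↔ (k ≠ i ∧ k ≠ j ∧ k ≠ p ∧ k ≠ q) := by
    intro σ h hi hj k
    have hp : σ p = i := by rw [← hi, hinv h]
    have hq : σ q = j := by rw [← hj, hinv h]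
    have h1 : σ k = i ↔ k = p := by rw [← hp, σ.apply_eq_iff_eq]
    have h2 : σ k = j ↔ k = q := by rw [← hq, σ.apply_eq_iff_eq]
    have h3 : σ k = p ↔ k = i := by rw [← hi, σ.apply_eq_iff_eq]
    have h4 : σ k = q ↔ k = j := by rw [← hj, σ.apply_eq_iff_eq]
    simp only [ne_eq, h1, h2, h3, h4]
    tauto
  rw [haf, Finset.mul_sum]
  refine Finset.sum_bij'
    (fun σ hσ => σ.subtypePerm (hstable σ (by simp_all) (by simp_all) (by simp_all)))
    (fun τ _ => Equiv.swap i p * Equiv.swap j q * Equiv.Perm.ofSubtype τ) ?_ ?_ ?_ ?_ ?_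
  · intro σ hσ
    simp only [Finset.mem_filter, Finset.mem_univ, true_and] at hσ ⊢
    refine ⟨Equiv.ext fun k => Subtype.ext ?_, fun k hk => hσ.1.2 k (congrArg Subtype.val hk)⟩
    exact hinv hσ.1.1 k
  · intro τ hτ
    simp only [Finset.mem_filter, Finset.mem_univ, true_and] at hτ ⊢
    refine ⟨⟨Equiv.ext fun k => ?_, fun k => ?_⟩, ?_, ?_⟩
    · rw [Equiv.Perm.mul_apply, Equiv.Perm.one_apply]
      by_cases hk : k ≠ i ∧ k ≠ j ∧ k ≠ p ∧ k ≠ q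
      · lift k to {k // k ≠ i ∧ k ≠ j ∧ k ≠ p ∧ k ≠ q} using hk
        rw [hext, hext, hinv hτ.1]
      · rw [hext' τ k hk]
        rcases hcases k hk with rfl | rfl | rfl | rfl
        · rw [ei, hext' _ _ (by simp), ep]
        · rw [ej, hext' _ _ (by simp), eq]
        · rw [ep, hext' _ _ (by simp), ei]
        · rw [eq, hext' _ _ (by simp), ej]
    · by_cases hk : k ≠ i ∧ k ≠ j ∧ k ≠ p ∧ k ≠ q
      · lift k to {k // k ≠ i ∧ k ≠ j ∧ k ≠ p ∧ k ≠ q} using hk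
        rw [hext]
        exact fun h => hτ.2 k (Subtype.ext h)
      · rw [hext' τ k hk]
        rcases hcases k hk with rfl | rfl | rfl | rfl
        · rwa [ei]
        · rwa [ej]
        · rw [ep]; exact hpi.symm
        · rw [eq]; exact hqj.symm
    · rw [hext' _ _ (by simp), ei]
    · rw [hext' _ _ (by simp), ej]
  · intro σ hσ
    simp only [Finset.mem_filter, Finset.mem_univ, true_and] at hσ
    obtain ⟨⟨hsq, -⟩, hi, hj⟩ := hσ
    ext k
    by_cases hk : k ≠ i ∧ k ≠ j ∧ k ≠ p ∧ k ≠ q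
    · lift k to {k // k ≠ i ∧ k ≠ j ∧ k ≠ p ∧ k ≠ q} using hk
      rw [hext, Equiv.Perm.subtypePerm_apply]
    · rw [hext' _ k hk]
      rcases hcases k hk with rfl | rfl | rfl | rfl
      · rw [ei, hi]
      · rw [ej, hj]
      · rw [ep, ← hi, hinv hsq]
      · rw [eq, ← hj, hinv hsq]
  · intro τ hτ
    refine Equiv.ext fun k => Subtype.ext ?_
    exact hext τ k
  · intro σ hσ
    simp only [Finset.mem_filter, Finset.mem_univ, true_and] at hσ
    exact prod_filter_lt_involution_eq_mul hM hij hpi hpj hqi hqj hpq (hinv hσ.1.1) hσ.2.1 hσ.2.2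
      hσ.1.2 _ fun k => rfl

open Classical in
/-- Simultaneous expansion of the hafnian along two rows `i` and `j` whose common entry is zero. -/
theorem haf_eq_sum_of_apply_eq_zero {ι R : Type*} [Fintype ι] [CommRing R]
    {M : Matrix ι ι R} (hM : M.IsSymm) {i j : ι} (hij : i ≠ j) (h0 : M i j = 0) :
    haf M = ∑ pq : ι × ι,
      if pq.1 ≠ pq.2 ∧ pq.1 ≠ i ∧ pq.1 ≠ j ∧ pq.2 ≠ i ∧ pq.2 ≠ j then
        M i pq.1 * M j pq.2 *
          haf (M.submatrix (Subtype.val : {k // k ≠ i ∧ k ≠ j ∧ k ≠ pq.1 ∧ k ≠ pq.2} → ι)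
            Subtype.val)
      else 0 := by
  rw [haf, ← Finset.sum_fiberwise _ (fun σ : Equiv.Perm ι => (σ i, σ j))]
  refine Finset.sum_congr rfl fun ⟨p, q⟩ _ => ?_
  simp only [Finset.filter_filter, Prod.mk.injEq]
  split_ifs with h
  · obtain ⟨hpq, hpi, hpj, hqi, hqj⟩ := h
    exact sum_involutions_pairs_eq_haf hM hij hpi hpj hqi hqj hpq
  · refine Finset.sum_eq_zero fun σ hσ => ?_
    simp only [Finset.mem_filter, Finset.mem_univ, true_and] at hσ
    obtain ⟨⟨hσ, hfix⟩, rfl, rfl⟩ := hσ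
    have hinv : ∀ k, σ (σ k) = k := fun k => by
      rw [← Equiv.Perm.mul_apply, hσ, Equiv.Perm.one_apply]
    have hσi : σ i = j := by
      by_contra hne
      refine h ⟨σ.injective.ne hij, hfix i, hne, fun hj => hne ?_, hfix j⟩
      rw [← hj, hinv]
    have hσj : σ j = i := by rw [← hσi, hinv]
    rcases lt_or_gt_of_ne ((Fintype.equivFin ι).injective.ne hij) with hlt | hlt
    · exact Finset.prod_eq_zero (i := i) (by simpa [hσi] using hlt) (by rw [hσi, h0])
    · exact Finset.prod_eq_zero (i := j) (by simpa [hσj] using hlt) (by rw [hσj, hM.apply, h0])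

theorem isSymm_replaceRowCol {n : ℕ} {R : Type*} [CommRing R] {A : Matrix (Fin n) (Fin n) R}
    (hA : A.IsSymm) (i j : Fin n) : (replaceRowCol A i j).IsSymm := by
  refine Matrix.IsSymm.ext fun k l => ?_
  simp only [replaceRowCol, Matrix.of_apply]
  split_ifs <;> first | rfl | exact hA.apply _ _

theorem delFour_comm {n : ℕ} {R : Type*} [CommRing R] (A : Matrix (Fin n) (Fin n) R)
    (i j p q : Fin n) : haf (delFour A i j p q) = haf (delFour A i j q p) :=
  haf_submatrix_val_congr A fun k => by tauto

/-- A sum over ordered pairs of distinct elements is a sum over the increasing pairs. -/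
theorem Finset.sum_filter_ne_eq_sum_filter_lt {α R : Type*} [Fintype α] [LinearOrder α]
    [AddCommMonoid R] (P : α → Prop) [DecidablePred P] (f : α → α → R) :
    ∑ pq : α × α with pq.1 ≠ pq.2 ∧ P pq.1 ∧ P pq.2, f pq.1 pq.2 =
      ∑ pq : α × α with pq.1 < pq.2 ∧ P pq.1 ∧ P pq.2, (f pq.1 pq.2 + f pq.2 pq.1) := by
  have hswap : ∑ pq : α × α with pq.1 < pq.2 ∧ P pq.1 ∧ P pq.2, f pq.2 pq.1 =
      ∑ pq : α × α with pq.2 < pq.1 ∧ P pq.1 ∧ P pq.2, f pq.1 pq.2 :=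
    Finset.sum_equiv (Equiv.prodComm α α) (by simp; tauto) (by simp)
  rw [Finset.sum_add_distrib, hswap, ← Finset.sum_union]
  · refine Finset.sum_congr (Finset.ext fun pq => ?_) fun _ _ => rfl
    simp only [Finset.mem_filter, Finset.mem_univ, true_and, Finset.mem_union, ne_iff_lt_or_gt]
    tauto
  · refine Finset.disjoint_filter.2 fun pq _ h h' => h.1.not_gt h'.1

/-- For a symmetric `2n × 2n` matrix (`n ≥ 2`) with zero diagonal
and distinct indices `i ≠ j`:
`haf A(i→j) = Σ_{{p,q}} 2·a_{ip}·a_{iq}·haf A[i,j,p,q]`, the sum being over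
unordered pairs `{p,q}` of distinct indices avoiding `i, j` (encoded as ordered
pairs with `p < q`).  In particular `haf A(i→j)` is divisible by `2` in `R`. -/
theorem haf_replaceRowCol {n : ℕ} (hn : 2 ≤ n) {R : Type*} [CommRing R]
    (A : Matrix (Fin (2 * n)) (Fin (2 * n)) R) (hA : A.IsSymm)
    (hdiag : ∀ k, A k k = 0) (i j : Fin (2 * n)) (hij : i ≠ j) :
    (haf (replaceRowCol A i j) =
      ∑ pq ∈ Finset.univ.filter
          (fun pq : Fin (2 * n) × Fin (2 * n) =>
            pq.1 < pq.2 ∧ pq.1 ≠ i ∧ pq.1 ≠ j ∧ pq.2 ≠ i ∧ pq.2 ≠ j),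
        2 * A i pq.1 * A i pq.2 * haf (delFour A i j pq.1 pq.2)) ∧
    ∃ r : R, haf (replaceRowCol A i j) = 2 * r := by
  have hfst : haf (replaceRowCol A i j) =
      ∑ pq ∈ Finset.univ.filter
          (fun pq : Fin (2 * n) × Fin (2 * n) =>
            pq.1 < pq.2 ∧ pq.1 ≠ i ∧ pq.1 ≠ j ∧ pq.2 ≠ i ∧ pq.2 ≠ j),
        2 * A i pq.1 * A i pq.2 * haf (delFour A i j pq.1 pq.2) := by
    have hzero : replaceRowCol A i j i j = 0 := by simp [replaceRowCol, hij, hdiag]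
    have hterm : haf (replaceRowCol A i j) =
        ∑ pq : Fin (2 * n) × Fin (2 * n) with
          pq.1 ≠ pq.2 ∧ (pq.1 ≠ i ∧ pq.1 ≠ j) ∧ (pq.2 ≠ i ∧ pq.2 ≠ j),
          A i pq.1 * A i pq.2 * haf (delFour A i j pq.1 pq.2) := by
      rw [haf_eq_sum_of_apply_eq_zero (isSymm_replaceRowCol hA i j) hij hzero, Finset.sum_filter]
      refine Finset.sum_congr rfl fun pq _ => ?_
      simp only [and_assoc]
      split_ifs with h
      · have hsub : (replaceRowCol A i j).submatrix
            (Subtype.val : {k // k ≠ i ∧ k ≠ j ∧ k ≠ pq.1 ∧ k ≠ pq.2} → Fin (2 * n))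
              (Subtype.val : {k // k ≠ i ∧ k ≠ j ∧ k ≠ pq.1 ∧ k ≠ pq.2} → Fin (2 * n)) =
            A.submatrix
              (Subtype.val : {k // k ≠ i ∧ k ≠ j ∧ k ≠ pq.1 ∧ k ≠ pq.2} → Fin (2 * n))
              (Subtype.val : {k // k ≠ i ∧ k ≠ j ∧ k ≠ pq.1 ∧ k ≠ pq.2} → Fin (2 * n)) := by
          ext k l
          simp [replaceRowCol, k.2.2.1, l.2.2.1]
        rw [hsub]
        refine congrArg₂ _ ?_ (haf_submatrix_val_congr A fun k => Iff.rfl)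
        simp [replaceRowCol, hij, h]
      · rfl
    rw [hterm, Finset.sum_filter_ne_eq_sum_filter_lt (fun k => k ≠ i ∧ k ≠ j)
      (fun p q => A i p * A i q * haf (delFour A i j p q))]
    simp only [and_assoc]
    refine Finset.sum_congr rfl fun pq _ => ?_
    rw [delFour_comm A i j pq.2 pq.1]
    ring
  have hdvd : 2 ∣ haf (replaceRowCol A i j) := by
    rw [hfst]
    refine Finset.dvd_sum fun pq _ => ?_
    rw [mul_assoc, mul_assoc]
    exact dvd_mul_right _ _
  exact ⟨hfst, hdvd⟩
end

section
/- Let m and n be positive integers, let E = {e_1,…,e_m}, and let 𝓕 be a nonempty family of subsets of E. Assign to each element e_i a weight w(e_i) chosen independently and uniformly at random from {2mn, 2mn+1, …, 2mn+2m−1}. Then, with probability greater than 1/2, there exists a unique set F ∈ 𝓕 of minimum weight w(F) := Σ_{e ∈ F} w(e). -/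
open scoped Classical

namespace Isolation

/-- `A` has minimum weight in the family `𝓕`. -/
def IsMin {E : Type*} (𝓕 : Finset (Finset E)) (w : E → ℕ) (A : Finset E) : Prop :=
  A ∈ 𝓕 ∧ ∀ B ∈ 𝓕, ∑ e ∈ A, w e ≤ ∑ e ∈ B, w e

/-- Some minimum-weight set contains `e` and some other one avoids it. -/
def Ambiguous {E : Type*} (𝓕 : Finset (Finset E)) (w : E → ℕ) (e : E) : Prop :=
  ∃ A B, IsMin 𝓕 w A ∧ IsMin 𝓕 w B ∧ e ∈ A ∧ e ∉ B

variable {E : Type*} {𝓕 : Finset (Finset E)} {w w' : E → ℕ} {e : E}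

theorem Ambiguous.le (h : Ambiguous 𝓕 w e) (h' : Ambiguous 𝓕 w' e)
    (hw : ∀ x, x ≠ e → w x = w' x) : w e ≤ w' e := by
  obtain ⟨A, B, hA, hB, heA, heB⟩ := h
  obtain ⟨A', B', hA', hB', heA', heB'⟩ := h'
  have avoid : ∀ C : Finset E, e ∉ C → ∑ x ∈ C, w x = ∑ x ∈ C, w' x := fun C hC =>
    Finset.sum_congr rfl fun x hx => hw x (ne_of_mem_of_not_mem hx hC)
  have h₁ := avoid B heB
  have h₂ := avoid B' heB'
  have h₃ := avoid (A.erase e) (Finset.notMem_erase e A)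
  have h₄ := Finset.add_sum_erase A w heA
  have h₅ := Finset.add_sum_erase A w' heA
  have h₆ := hA.2 B' hB'.1
  have h₇ := hB.2 A hA.1
  have h₈ := hB'.2 A hA.1
  omega

theorem Ambiguous.eq (h : Ambiguous 𝓕 w e) (h' : Ambiguous 𝓕 w' e)
    (hw : ∀ x, x ≠ e → w x = w' x) : w e = w' e :=
  le_antisymm (h.le h' hw) (h'.le h fun x hx => (hw x hx).symm)

/-- With positive weights, distinct minimum-weight sets are not nested. -/
theorem IsMin.exists_mem_notMem (hw : ∀ x, 0 < w x) {A B : Finset E}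
    (hA : IsMin 𝓕 w A) (hB : IsMin 𝓕 w B) (hAB : A ≠ B) : ∃ x ∈ A, x ∉ B := by
  by_contra! h
  obtain ⟨y, hyB, hyA⟩ := Finset.exists_of_ssubset (Finset.ssubset_iff_subset_ne.2 ⟨h, hAB⟩)
  exact (Finset.sum_lt_sum_of_subset h hyB hyA (hw y) fun _ _ _ => Nat.zero_le _).not_ge
    (hB.2 A hA.1)

theorem exists_isMin (h𝓕 : 𝓕.Nonempty) (w : E → ℕ) : ∃ A, IsMin 𝓕 w A :=
  Finset.exists_min_image 𝓕 (fun A => ∑ e ∈ A, w e) h𝓕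

/-- With positive weights, non-uniqueness of the minimum yields two ambiguous elements. -/
theorem two_le_card_ambiguous [Fintype E] (h𝓕 : 𝓕.Nonempty) (hw : ∀ x, 0 < w x)
    (h : ¬ ∃! A, IsMin 𝓕 w A) : 2 ≤ (Finset.univ.filter (Ambiguous 𝓕 w)).card := by
  obtain ⟨A, hA⟩ := exists_isMin h𝓕 w
  obtain ⟨B, hB, hBA⟩ : ∃ B, IsMin 𝓕 w B ∧ B ≠ A := by
    by_contra! h'
    exact h ⟨A, hA, h'⟩
  obtain ⟨x, hxA, hxB⟩ := hA.exists_mem_notMem hw hB hBA.symm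
  obtain ⟨y, hyB, hyA⟩ := hB.exists_mem_notMem hw hA hBA
  refine Finset.one_lt_card.2 ⟨x, ?_, y, ?_, ne_of_mem_of_not_mem hxA hyA⟩
  · simpa using ⟨A, B, hA, hB, hxA, hxB⟩
  · simpa using ⟨B, A, hB, hA, hyB, hyA⟩

/-- An element is ambiguous for at most one of its `N` possible weights, the others being fixed. -/
theorem card_ambiguous_mul_le [Fintype E] [DecidableEq E] (𝓕 : Finset (Finset E))
    (c N : ℕ) (e : E) :
    (Finset.univ.filter fun ω : E → Fin N => Ambiguous 𝓕 (fun x => c + (ω x : ℕ)) e).card * N ≤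
      Fintype.card (E → Fin N) := by
  set S := Finset.univ.filter fun ω : E → Fin N => Ambiguous 𝓕 (fun x => c + (ω x : ℕ)) e with hS
  have hcard : (S ×ˢ (Finset.univ : Finset (Fin N))).card = S.card * N := by simp
  rw [← hcard, ← Finset.card_univ]
  refine Finset.card_le_card_of_injOn (fun p => Function.update p.1 e p.2)
    (fun _ _ => Finset.mem_coe.2 (Finset.mem_univ _)) ?_
  rintro ⟨ω, k⟩ hω ⟨ω', k'⟩ hω' h
  simp only [Finset.coe_product, Set.mem_prod, Finset.mem_coe, hS, Finset.mem_filter,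
    Finset.mem_univ, true_and, and_true] at hω hω'
  have hk : k = k' := by simpa using congrFun h e
  have hoff : ∀ x, x ≠ e → ω x = ω' x := fun x hx => by simpa [hx] using congrFun h x
  have he : c + (ω e : ℕ) = c + (ω' e : ℕ) := hω.eq hω' fun x hx => by rw [hoff x hx]
  refine Prod.ext (funext fun x => ?_) hk
  by_cases hx : x = e
  · subst hx
    exact Fin.ext (Nat.add_left_cancel he)
  · exact hoff x hx

theorem four_mul_card_not_unique_le [Fintype E] [DecidableEq E] (h𝓕 : 𝓕.Nonempty)
    {c : ℕ} (hc : 0 < c) (hE : 0 < Fintype.card E) :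
    4 * (Finset.univ.filter fun ω : E → Fin (2 * Fintype.card E) =>
      ¬ ∃! A, IsMin 𝓕 (fun x => c + (ω x : ℕ)) A).card ≤
      Fintype.card (E → Fin (2 * Fintype.card E)) := by
  set m := Fintype.card E
  set T := Finset.univ.filter fun ω : E → Fin (2 * m) =>
    ¬ ∃! A, IsMin 𝓕 (fun x => c + (ω x : ℕ)) A
  have hlow : T.card * 2 ≤ ∑ e : E, (Finset.univ.filter fun ω : E → Fin (2 * m) =>
      Ambiguous 𝓕 (fun x => c + (ω x : ℕ)) e).card := by
    calc T.card * 2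
        ≤ ∑ ω ∈ T, (Finset.univ.filter (Ambiguous 𝓕 fun x => c + (ω x : ℕ))).card := by
          rw [← smul_eq_mul]
          refine Finset.card_nsmul_le_sum _ _ _ fun ω hω => ?_
          exact two_le_card_ambiguous h𝓕 (fun x => by omega) (Finset.mem_filter.1 hω).2
      _ ≤ ∑ ω : E → Fin (2 * m),
            (Finset.univ.filter (Ambiguous 𝓕 fun x => c + (ω x : ℕ))).card :=
          Finset.sum_le_sum_of_subset (Finset.subset_univ T)
      _ = _ := by
          simp only [Finset.card_filter]
          exact Finset.sum_comm
  have hup : (∑ e : E, (Finset.univ.filter fun ω : E → Fin (2 * m) =>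
      Ambiguous 𝓕 (fun x => c + (ω x : ℕ)) e).card) * (2 * m) ≤
      m * Fintype.card (E → Fin (2 * m)) := by
    rw [Finset.sum_mul]
    calc _ ≤ ∑ _e : E, Fintype.card (E → Fin (2 * m)) :=
          Finset.sum_le_sum fun e _ => card_ambiguous_mul_le 𝓕 c (2 * m) e
      _ = _ := by rw [Finset.sum_const, Finset.card_univ, smul_eq_mul]
  refine Nat.le_of_mul_le_mul_left ?_ hE
  calc m * (4 * T.card) = T.card * 2 * (2 * m) := by ring
    _ ≤ _ := (Nat.mul_le_mul_right _ hlow).trans hup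

end Isolation

/-- **Isolation Lemma.** Let `E` be a set of `m ≥ 1` elements,
`n ≥ 1`, and `𝓕` a nonempty family of subsets of `E`.  If each element `e` of `E`
gets a weight `w(e) = 2mn + ω(e)` with `ω(e)` chosen independently and uniformly
at random from `{0, …, 2m−1}` (so `w(e)` is uniform on `{2mn, …, 2mn+2m−1}`),
then with probability greater than `1/2` there is a unique set `F ∈ 𝓕` of minimum
weight `w(F) = Σ_{e ∈ F} w(e)`.  Probability is expressed by counting sample
points `ω : E → Fin (2m)`. -/
theorem isolation_lemma {m n : ℕ} (hm : 0 < m) (hn : 0 < n)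
    {E : Type*} [Fintype E] [DecidableEq E] (hE : Fintype.card E = m)
    (𝓕 : Finset (Finset E)) (h𝓕 : 𝓕.Nonempty) :
    Fintype.card (E → Fin (2 * m)) <
      2 * (Finset.univ.filter (fun ω : E → Fin (2 * m) =>
        ∃! F, F ∈ 𝓕 ∧ ∀ F' ∈ 𝓕,
          (∑ e ∈ F, (2 * m * n + ((ω e : ℕ)))) ≤
            ∑ e ∈ F', (2 * m * n + ((ω e : ℕ))))).card := by
  subst hE
  have hbad := Isolation.four_mul_card_not_unique_le h𝓕
    (show 0 < 2 * Fintype.card E * n by positivity) hm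
  have hsum := Finset.card_filter_add_card_filter_not (s := Finset.univ)
    fun ω : E → Fin (2 * Fintype.card E) =>
      ∃! A, Isolation.IsMin 𝓕 (fun x => 2 * Fintype.card E * n + (ω x : ℕ)) A
  have : NeZero (2 * Fintype.card E) := ⟨by omega⟩
  have hpos : 0 < Fintype.card (E → Fin (2 * Fintype.card E)) := Fintype.card_pos
  rw [Finset.card_univ] at hsum
  simp only [Isolation.IsMin] at hbad hsum
  have key : ∀ a b t : ℕ, 4 * b ≤ t → a + b = t → 0 < t → t < 2 * a := by omega
  refine key _ _ _ hbad ?_ hpos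
  convert hsum
end
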